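/- There is no cubic surface of rank exactly 6 whose set of singular points in P^3(ℂ) consists of exactly four points. -/

import Mathlib

open MvPolynomial

/-- The linear form with coefficient vector `v`. -/
noncomputable def linForm {n : ℕ} (v : Fin n → ℂ) : MvPolynomial (Fin n) ℂ :=
  ∑ i, C (v i) * X i

/-- `f` can be written as a sum of `r` `d`-th powers of linear forms. -/
def hasDecomp {n : ℕ} (d : ℕ) (f : MvPolynomial (Fin n) ℂ) (r : ℕ) : Prop :=
  ∃ v : Fin r → Fin n → ℂ, f = ∑ j, (linForm (v j)) ^ d

/-- `f` has rank exactly `r` with respect to `d`-th powers of linear forms. -/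
def hasRank {n : ℕ} (d : ℕ) (f : MvPolynomial (Fin n) ℂ) (r : ℕ) : Prop :=
  hasDecomp d f r ∧ ∀ s, s < r → ¬ hasDecomp d f s

/-- The symmetric trilinear form attached to a sum of cubes. -/
noncomputable def triForm {n m : ℕ} (v : Fin m → Fin n → ℂ) (a b c : Fin n → ℂ) : ℂ :=
  ∑ j, (v j ⬝ᵥ a) * (v j ⬝ᵥ b) * (v j ⬝ᵥ c)

section tri
variable {n m : ℕ} (v : Fin m → Fin n → ℂ)

lemma tri_comm12 (a b c : Fin n → ℂ) : triForm v a b c = triForm v b a c := by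
  unfold triForm; refine Finset.sum_congr rfl fun j _ => by ring

lemma tri_comm23 (a b c : Fin n → ℂ) : triForm v a b c = triForm v a c b := by
  unfold triForm; refine Finset.sum_congr rfl fun j _ => by ring

lemma tri_add1 (a a' b c : Fin n → ℂ) :
    triForm v (a + a') b c = triForm v a b c + triForm v a' b c := by
  unfold triForm; rw [← Finset.sum_add_distrib]
  refine Finset.sum_congr rfl fun j _ => by rw [dotProduct_add]; ring

lemma tri_smul1 (t : ℂ) (a b c : Fin n → ℂ) :
    triForm v (t • a) b c = t * triForm v a b c := by
  unfold triForm; rw [Finset.mul_sum]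
  refine Finset.sum_congr rfl fun j _ => by rw [dotProduct_smul, smul_eq_mul]; ring

lemma tri_add2 (a a' b c : Fin n → ℂ) :
    triForm v b (a + a') c = triForm v b a c + triForm v b a' c := by
  rw [tri_comm12, tri_add1, tri_comm12 v a, tri_comm12 v a']

lemma tri_smul2 (t : ℂ) (a b c : Fin n → ℂ) :
    triForm v b (t • a) c = t * triForm v b a c := by
  rw [tri_comm12, tri_smul1, tri_comm12 v a]

lemma tri_add3 (a a' b c : Fin n → ℂ) :
    triForm v b c (a + a') = triForm v b c a + triForm v b c a' := by
  rw [tri_comm23, tri_add2, tri_comm23 v b a, tri_comm23 v b a']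

lemma tri_smul3 (t : ℂ) (a b c : Fin n → ℂ) :
    triForm v b c (t • a) = t * triForm v b c a := by
  rw [tri_comm23, tri_smul2, tri_comm23 v b a]

/-- Singular vectors of the cubic. -/
def SingVec (p : Fin n → ℂ) : Prop := ∀ w, triForm v w p p = 0

variable {v}
lemma SingVec.s2 {p : Fin n → ℂ} (h : SingVec v p) (w) : triForm v p w p = 0 := by
  rw [tri_comm12]; exact h w
lemma SingVec.s3 {p : Fin n → ℂ} (h : SingVec v p) (w) : triForm v p p w = 0 := by
  rw [tri_comm23]; exact h.s2 w
end tri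

/-- Every singular vector lies on one of the four given lines. -/
def OnlySing {m : ℕ} (v : Fin m → Fin 4 → ℂ) (p q r s : Fin 4 → ℂ) : Prop :=
  ∀ u, u ≠ 0 → SingVec v u →
    (∃ c : ℂ, u = c • p) ∨ (∃ c : ℂ, u = c • q) ∨ (∃ c : ℂ, u = c • r) ∨ (∃ c : ℂ, u = c • s)

lemma indep3 {q r s : Fin 4 → ℂ} (h : LinearIndependent ℂ ![q, r, s]) {x y z : ℂ}
    (h0 : x • q + y • r + z • s = 0) : x = 0 ∧ y = 0 ∧ z = 0 := by
  have := Fintype.linearIndependent_iff.1 h ![x, y, z] (by simpa [Fin.sum_univ_three] using h0)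
  exact ⟨this 0, this 1, this 2⟩

lemma indep2 {q r : Fin 4 → ℂ} (h : LinearIndependent ℂ ![q, r]) {x y : ℂ}
    (h0 : x • q + y • r = 0) : x = 0 ∧ y = 0 := by
  have := Fintype.linearIndependent_iff.1 h ![x, y] (by simpa [Fin.sum_univ_two] using h0)
  exact ⟨this 0, this 1⟩

/-- A plane section consisting of a conic of singular points is impossible. -/
lemma planeCase {m : ℕ} (v : Fin m → Fin 4 → ℂ) {e p q r s : Fin 4 → ℂ}
    (hq : SingVec v q) (hr : SingVec v r) (hs : SingVec v s)
    (hli : LinearIndependent ℂ ![q, r, s])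
    (hspan : ∀ w : Fin 4 → ℂ, ∃ a x y z : ℂ, w = a • e + (x • q + y • r + z • s))
    (h0 : triForm v q r s = 0) (H : OnlySing v p q r s) : False := by
  -- singularity criterion
  have e1 : triForm v q s r = 0 := by rw [tri_comm23]; exact h0
  have e2 : triForm v r q s = 0 := by rw [tri_comm12]; exact h0
  have e3 : triForm v r s q = 0 := by rw [tri_comm23]; exact e2
  have e4 : triForm v s q r = 0 := by rw [tri_comm12]; exact e1
  have e5 : triForm v s r q = 0 := by rw [tri_comm23]; exact e4
  have crit : ∀ x y z : ℂ, triForm v e r s * y * z + triForm v e q s * x * z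
      + triForm v e q r * x * y = 0 → SingVec v (x • q + y • r + z • s) := by
    intro x y z h w
    obtain ⟨a, x', y', z', rfl⟩ := hspan w
    simp only [tri_add1, tri_add2, tri_add3, tri_smul1, tri_smul2, tri_smul3, h0, e1, e2, e3, e4,
      e5, hq _, hr _, hs _, hq.s2, hr.s2, hs.s2, hq.s3, hr.s3, hs.s3]
    rw [tri_comm23 v e s r, tri_comm23 v e s q, tri_comm23 v e r q]
    linear_combination 2 * a * h
  -- a point of the plane with two nonzero coordinates lies on the line of `p`
  have onp : ∀ x y z : ℂ, triForm v e r s * y * z + triForm v e q s * x * z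
      + triForm v e q r * x * y = 0 → ((x ≠ 0 ∧ y ≠ 0) ∨ (x ≠ 0 ∧ z ≠ 0) ∨ (y ≠ 0 ∧ z ≠ 0)) →
      ∃ c : ℂ, c ≠ 0 ∧ x • q + y • r + z • s = c • p := by
    intro x y z h hne
    have hu : x • q + y • r + z • s ≠ 0 := by
      intro hh
      have := indep3 hli hh
      tauto
    rcases H _ hu (crit x y z h) with ⟨c, hc⟩ | ⟨c, hc⟩ | ⟨c, hc⟩ | ⟨c, hc⟩
    · refine ⟨c, ?_, hc⟩
      rintro rfl
      exact hu (by simpa using hc)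
    · have := indep3 hli (x := x - c) (y := y) (z := z) (by
        linear_combination (norm := module) hc)
      tauto
    · have := indep3 hli (x := x) (y := y - c) (z := z) (by
        linear_combination (norm := module) hc)
      tauto
    · have := indep3 hli (x := x) (y := y) (z := z - c) (by
        linear_combination (norm := module) hc)
      tauto
  have two : ∀ x y z x' y' z' : ℂ, (∃ c : ℂ, c ≠ 0 ∧ x • q + y • r + z • s = c • p) →
      (∃ c : ℂ, c ≠ 0 ∧ x' • q + y' • r + z' • s = c • p) →
      x * y' = x' * y ∧ x * z' = x' * z ∧ y * z' = y' * z := by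
    rintro x y z x' y' z' ⟨c, hc, h⟩ ⟨d, hd, h'⟩
    obtain ⟨h1, h2, h3⟩ := indep3 hli (x := d * x - c * x') (y := d * y - c * y')
      (z := d * z - c * z') (by
        linear_combination (norm := module) d • h - c • h')
    refine ⟨?_, ?_, ?_⟩
    · apply mul_left_cancel₀ hd; linear_combination y' * h1 - x' * h2
    · apply mul_left_cancel₀ hd; linear_combination z' * h1 - x' * h3
    · apply mul_left_cancel₀ hd; linear_combination z' * h2 - y' * h3
  by_cases hb : triForm v e r s = 0
  · have := two 0 1 1 0 1 2 (onp _ _ _ (by rw [hb]; ring) (by simp))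
      (onp _ _ _ (by rw [hb]; ring) (by simp))
    norm_num at this
  by_cases hc : triForm v e q s = 0
  · have := two 1 0 1 1 0 2 (onp _ _ _ (by rw [hc]; ring) (by simp))
      (onp _ _ _ (by rw [hc]; ring) (by simp))
    norm_num at this
  by_cases hd : triForm v e q r = 0
  · have := two 1 1 0 1 2 0 (onp _ _ _ (by rw [hd]; ring) (by simp))
      (onp _ _ _ (by rw [hd]; ring) (by simp))
    norm_num at this
  have := two (2 * triForm v e r s) (2 * triForm v e q s) (- triForm v e q r)
    (2 * triForm v e r s) (- triForm v e q s) (2 * triForm v e q r)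
    (onp _ _ _ (by ring) (by simp [hb, hc])) (onp _ _ _ (by ring) (by simp [hb, hc]))
  have h6 : triForm v e r s * triForm v e q s = 0 := by
    linear_combination (-1 / 6 : ℂ) * this.1
  rcases mul_eq_zero.1 h6 with h | h
  · exact hb h
  · exact hc h

/-- Three collinear singular points are impossible. -/
lemma lineCase {m : ℕ} (v : Fin m → Fin 4 → ℂ) {p q r s : Fin 4 → ℂ} {α β : ℂ}
    (hp : SingVec v p) (hq : SingVec v q) (hr : SingVec v r)
    (hli : LinearIndependent ℂ ![p, q]) (hα : α ≠ 0) (hβ : β ≠ 0)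
    (hrpq : r = α • p + β • q) (H : OnlySing v p q r s) : False := by
  have hw : ∀ w, triForm v w p q = 0 := by
    intro w
    have h := hr w
    rw [hrpq] at h
    simp only [tri_add2, tri_add3, tri_smul2, tri_smul3, hp _, hq _, tri_comm23 v w q p] at h
    have : (2 * α * β) * triForm v w p q = 0 := by linear_combination h
    rcases mul_eq_zero.1 this with h | h
    · simp [hα, hβ] at h
    · exact h
  have onrs : ∀ t : ℂ, t ≠ 0 → (∃ c : ℂ, c ≠ 0 ∧ p + t • q = c • r) ∨
      (∃ c : ℂ, c ≠ 0 ∧ p + t • q = c • s) := by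
    intro t ht
    have hu : p + t • q ≠ 0 := by
      intro hh
      have := indep2 hli (x := 1) (y := t) (by simpa using hh)
      simp at this
    have hsing : SingVec v (p + t • q) := by
      intro w
      simp only [tri_add2, tri_add3, tri_smul2, tri_smul3, hp _, hq _, tri_comm23 v w q p, hw]
      ring
    rcases H _ hu hsing with ⟨c, hc⟩ | ⟨c, hc⟩ | ⟨c, hc⟩ | ⟨c, hc⟩
    · have := indep2 hli (x := 1 - c) (y := t) (by linear_combination (norm := module) hc)
      tauto
    · have := indep2 hli (x := 1) (y := t - c) (by linear_combination (norm := module) hc)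
      simp at this
    · left; refine ⟨c, ?_, hc⟩
      rintro rfl
      exact hu (by simpa using hc)
    · right; refine ⟨c, ?_, hc⟩
      rintro rfl
      exact hu (by simpa using hc)
  have two : ∀ (x : Fin 4 → ℂ) (t t' : ℂ), (∃ c : ℂ, c ≠ 0 ∧ p + t • q = c • x) →
      (∃ c : ℂ, c ≠ 0 ∧ p + t' • q = c • x) → t = t' := by
    rintro x t t' ⟨c, hc, h⟩ ⟨d, hd, h'⟩
    obtain ⟨h1, h2⟩ := indep2 hli (x := d - c) (y := d * t - c * t') (by
      linear_combination (norm := module) d • h - c • h')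
    apply mul_left_cancel₀ hd
    linear_combination h2 - t' * h1
  have k1 := onrs 1 (by norm_num)
  have k2 := onrs 2 (by norm_num)
  have k3 := onrs 3 (by norm_num)
  rcases k1 with k1 | k1 <;> rcases k2 with k2 | k2 <;> rcases k3 with k3 | k3 <;>
    first
    | (have := two _ _ _ k1 k2; norm_num at this; done)
    | (have := two _ _ _ k1 k3; norm_num at this; done)
    | (have := two _ _ _ k2 k3; norm_num at this; done)

lemma eval_linForm {n : ℕ} (v u : Fin n → ℂ) : eval u (linForm v) = v ⬝ᵥ u := by
  simp [linForm, dotProduct]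

lemma eval_dual {n : ℕ} (L : (Fin n → ℂ) →ₗ[ℂ] ℂ) (u : Fin n → ℂ) :
    eval u (linForm (fun i => L (Pi.single i 1))) = L u := by
  rw [eval_linForm, LinearMap.pi_apply_eq_sum_univ L u]
  simp only [dotProduct, smul_eq_mul]
  refine Finset.sum_congr rfl fun i _ => ?_
  rw [mul_comm]
  congr 2
  ext j
  simp [Pi.single_apply, eq_comm]

lemma eval_cubes {n m : ℕ} (v : Fin m → Fin n → ℂ) (u : Fin n → ℂ) :
    eval u (∑ j, linForm (v j) ^ 3) = triForm v u u u := by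
  simp only [map_sum, map_pow, eval_linForm, triForm]
  refine Finset.sum_congr rfl fun i _ => by ring

lemma pderiv_linForm {n : ℕ} (v : Fin n → ℂ) (i : Fin n) :
    pderiv i (linForm v) = C (v i) := by
  simp [linForm, pderiv_X, Pi.single_apply, eq_comm]

lemma eval_pderiv_cubes {n m : ℕ} (v : Fin m → Fin n → ℂ) (u : Fin n → ℂ) (i : Fin n) :
    eval u (pderiv i (∑ j, linForm (v j) ^ 3)) = 3 * triForm v (Pi.single i 1) u u := by
  simp only [map_sum, pderiv_pow, pderiv_linForm, triForm, Finset.mul_sum]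
  refine Finset.sum_congr rfl fun j _ => ?_
  simp [eval_linForm]
  ring

lemma singVec_iff {n m : ℕ} (v : Fin m → Fin n → ℂ) (u : Fin n → ℂ) :
    (∀ i, eval u (pderiv i (∑ j, linForm (v j) ^ 3)) = 0) ↔ SingVec v u := by
  constructor
  · intro h w
    have h' : ∀ i, triForm v (Pi.single i 1) u u = 0 := by
      intro i
      have := h i
      rw [eval_pderiv_cubes] at this
      simpa using this
    let L : (Fin n → ℂ) →ₗ[ℂ] ℂ :=
      { toFun := fun w => triForm v w u u
        map_add' := fun a b => tri_add1 v a b u u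
        map_smul' := fun t a => tri_smul1 v t a u u }
    have hL : L = 0 := by
      ext i
      exact h' i
    exact LinearMap.congr_fun hL w
  · intro h i
    rw [eval_pderiv_cubes, h]; simp

/-- The Cayley cubic is a sum of five cubes. -/
lemma cayley_decomp {m : ℕ} (v : Fin m → Fin 4 → ℂ) {p q r s : Fin 4 → ℂ}
    (hp : SingVec v p) (hq : SingVec v q) (hr : SingVec v r) (hs : SingVec v s)
    (hli : LinearIndependent ℂ ![p, q, r, s])
    (h1 : triForm v q r s ≠ 0) (h2 : triForm v p r s ≠ 0) (h3 : triForm v p q s ≠ 0)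
    (h4 : triForm v p q r ≠ 0) : hasDecomp 3 (∑ j, linForm (v j) ^ 3) 5 := by
  let B := basisOfLinearIndependentOfCardEqFinrank hli (by simp)
  have hB : ∀ u : Fin 4 → ℂ, u = B.coord 0 u • p + B.coord 1 u • q + B.coord 2 u • r
      + B.coord 3 u • s := by
    intro u
    conv_lhs => rw [← B.sum_repr u]
    simp [Fin.sum_univ_four, B]
  set a := triForm v q r s with ha
  set b := triForm v p r s with hb
  set c := triForm v p q s with hc
  set d := triForm v p q r with hd
  obtain ⟨γ, hγ⟩ := IsAlgClosed.exists_pow_nat_eq (-(6 * (a * b * c * d)) / 24) (n := 3) (by norm_num)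
  obtain ⟨δ, hδ⟩ := IsAlgClosed.exists_pow_nat_eq ((6 * (a * b * c * d)) / 12) (n := 3) (by norm_num)
  let z0 := a⁻¹ • B.coord 0
  let z1 := b⁻¹ • B.coord 1
  let z2 := c⁻¹ • B.coord 2
  let z3 := d⁻¹ • B.coord 3
  let S := z0 + z1 + z2 + z3
  let L : Fin 5 → ((Fin 4 → ℂ) →ₗ[ℂ] ℂ) := ![γ • (S - (2 : ℂ) • z0), γ • (S - (2 : ℂ) • z1),
    γ • (S - (2 : ℂ) • z2), γ • (S - (2 : ℂ) • z3), δ • S]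
  refine ⟨fun j i => L j (Pi.single i 1), ?_⟩
  apply MvPolynomial.funext
  intro u
  rw [eval_cubes]
  simp only [map_sum, map_pow, eval_dual]
  have hx0 : B.coord 0 u = a * z0 u := by simp [z0, h1]
  have hx1 : B.coord 1 u = b * z1 u := by simp [z1, h2]
  have hx2 : B.coord 2 u = c * z2 u := by simp [z2, h3]
  have hx3 : B.coord 3 u = d * z3 u := by simp [z3, h4]
  have hu := hB u
  rw [hx0, hx1, hx2, hx3] at hu
  have key : triForm v u u u = 6 * (a * b * c * d) * (z1 u * z2 u * z3 u + z0 u * z2 u * z3 u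
      + z0 u * z1 u * z3 u + z0 u * z1 u * z2 u) := by
    generalize z0 u = w0 at *
    generalize z1 u = w1 at *
    generalize z2 u = w2 at *
    generalize z3 u = w3 at *
    have perm : ∀ x y z, triForm v x z y = triForm v x y z ∧ triForm v y x z = triForm v x y z ∧
        triForm v y z x = triForm v x y z ∧ triForm v z x y = triForm v x y z ∧
        triForm v z y x = triForm v x y z := by
      intro x y z
      simp only [triForm]
      refine ⟨?_, ?_, ?_, ?_, ?_⟩ <;> exact Finset.sum_congr rfl fun j _ => by ring
    obtain ⟨a1, a2, a3, a4, a5⟩ := perm q r s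
    obtain ⟨b1, b2, b3, b4, b5⟩ := perm p r s
    obtain ⟨c1, c2, c3, c4, c5⟩ := perm p q s
    obtain ⟨d1, d2, d3, d4, d5⟩ := perm p q r
    rw [hu]
    simp only [tri_add1, tri_add2, tri_add3, tri_smul1, tri_smul2, tri_smul3, hp _, hq _, hr _,
      hs _, hp.s2, hq.s2, hr.s2, hs.s2, hp.s3, hq.s3, hr.s3, hs.s3, a1, a2, a3, a4, a5,
      b1, b2, b3, b4, b5, c1, c2, c3, c4, c5, d1, d2, d3, d4, d5, ← ha, ← hb, ← hc, ← hd]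
    ring
  rw [key]
  simp only [Fin.sum_univ_five, L, S, Matrix.cons_val, LinearMap.smul_apply, LinearMap.sub_apply,
    LinearMap.add_apply, smul_eq_mul, mul_pow, hγ, hδ]
  ring

lemma OnlySing.perm {m : ℕ} {v : Fin m → Fin 4 → ℂ} {p q r s p' q' r' s' : Fin 4 → ℂ}
    (H : OnlySing v p q r s)
    (h : ∀ P : (Fin 4 → ℂ) → Prop, P p ∨ P q ∨ P r ∨ P s → P p' ∨ P q' ∨ P r' ∨ P s') :
    OnlySing v p' q' r' s' :=
  fun u hu hs => h (fun x => ∃ c : ℂ, u = c • x) (H u hu hs)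

lemma mem_span3 {a b c d : Fin 4 → ℂ} (h : d ∈ Submodule.span ℂ (Set.range ![a, b, c])) :
    ∃ x y z : ℂ, d = x • a + y • b + z • c := by
  obtain ⟨f, hf⟩ := (Submodule.mem_span_range_iff_exists_fun ℂ).1 h
  exact ⟨f 0, f 1, f 2, by simpa [Fin.sum_univ_three] using hf.symm⟩

lemma mem_span2 {a b d : Fin 4 → ℂ} (h : d ∈ Submodule.span ℂ (Set.range ![a, b])) :
    ∃ x y : ℂ, d = x • a + y • b := by
  obtain ⟨f, hf⟩ := (Submodule.mem_span_range_iff_exists_fun ℂ).1 h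
  exact ⟨f 0, f 1, by simpa [Fin.sum_univ_two] using hf.symm⟩

lemma span4 {e a b c : Fin 4 → ℂ} (h : LinearIndependent ℂ ![e, a, b, c]) (w : Fin 4 → ℂ) :
    ∃ t x y z : ℂ, w = t • e + (x • a + y • b + z • c) := by
  have hs := h.span_eq_top_of_card_eq_finrank' (by simp)
  have hw : w ∈ Submodule.span ℂ (Set.range ![e, a, b, c]) := by rw [hs]; trivial
  obtain ⟨f, hf⟩ := (Submodule.mem_span_range_iff_exists_fun ℂ).1 hw
  refine ⟨f 0, f 1, f 2, f 3, ?_⟩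
  rw [← hf, Fin.sum_univ_four]
  simp [add_assoc]

/-- Vector form of the classification of cubics with exactly four singular points. -/
lemma four_sing {m : ℕ} (v : Fin m → Fin 4 → ℂ) (P : Fin 4 → Fin 4 → ℂ)
    (hP : ∀ i, SingVec v (P i)) (hne : ∀ i j, i ≠ j → LinearIndependent ℂ ![P i, P j])
    (H : OnlySing v (P 0) (P 1) (P 2) (P 3)) : hasDecomp 3 (∑ j, linForm (v j) ^ 3) 5 := by
  by_contra hcon
  -- a linear combination of two points that is another point has nonzero coefficients
  have coef : ∀ i j k : Fin 4, i ≠ k → j ≠ k → ∀ x y : ℂ, P k = x • P i + y • P j →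
      x ≠ 0 ∧ y ≠ 0 := by
    intro i j k hik hjk x y h
    refine ⟨?_, ?_⟩
    · rintro rfl
      have := indep2 (hne j k hjk) (x := y) (y := -1) (by
        linear_combination (norm := module) -h)
      simp at this
    · rintro rfl
      have := indep2 (hne i k hik) (x := x) (y := -1) (by
        linear_combination (norm := module) -h)
      simp at this
  have line : ∀ i j k l : Fin 4, i ≠ k → j ≠ k → i ≠ j → OnlySing v (P i) (P j) (P k) (P l) →
      ∀ x y : ℂ, P k = x • P i + y • P j → False := by
    intro i j k l hik hjk hij H' x y h
    obtain ⟨hx, hy⟩ := coef i j k hik hjk x y h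
    exact lineCase v (hP i) (hP j) (hP k) (hne i j hij) hx hy h H'
  have L3 : LinearIndependent ℂ ![P 2, P 0, P 1] := by
    refine LinearIndependent.finCons (hne 0 1 (by decide)) fun hmem => ?_
    obtain ⟨x, y, h⟩ := mem_span2 hmem
    exact line 0 1 2 3 (by decide) (by decide) (by decide) H x y h
  by_cases hd : P 3 ∈ Submodule.span ℂ (Set.range ![P 2, P 0, P 1])
  · obtain ⟨x, y, z, h⟩ := mem_span3 hd
    have hx : x ≠ 0 := by
      rintro rfl
      exact line 0 1 3 2 (by decide) (by decide) (by decide) (H.perm (by tauto)) y z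
        (by simpa using h)
    have hy : y ≠ 0 := by
      rintro rfl
      exact line 2 1 3 0 (by decide) (by decide) (by decide) (H.perm (by tauto)) x z
        (by simpa using h)
    have hz : z ≠ 0 := by
      rintro rfl
      exact line 2 0 3 1 (by decide) (by decide) (by decide) (H.perm (by tauto)) x y
        (by simpa using h)
    have h0 : triForm v (P 2) (P 0) (P 1) = 0 := by
      have h3 := hP 3 (P 2)
      rw [h] at h3
      simp only [tri_add2, tri_add3, tri_smul2, tri_smul3, hP _ _, (hP _).s2, (hP _).s3,
        tri_comm23 v (P 2) (P 1) (P 0)] at h3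
      have : (2 * y * z) * triForm v (P 2) (P 0) (P 1) = 0 := by linear_combination h3
      rcases mul_eq_zero.1 this with h | h
      · simp [hy, hz] at h
      · exact h
    obtain ⟨e, he⟩ : ∃ e, e ∉ Submodule.span ℂ (Set.range ![P 2, P 0, P 1]) := by
      by_contra hall
      push Not at hall
      have htop : Submodule.span ℂ (Set.range ![P 2, P 0, P 1]) = ⊤ := by
        rw [eq_top_iff]; intro w _; exact hall w
      have := finrank_span_eq_card L3
      rw [htop] at this
      simp at this
    exact planeCase v (hP 2) (hP 0) (hP 1) L3 (span4 (LinearIndependent.finCons L3 he)) h0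
      (p := P 3) (H.perm (by tauto))
  · have L4 : LinearIndependent ℂ ![P 3, P 2, P 0, P 1] := LinearIndependent.finCons L3 hd
    have sub : ∀ i j k : Fin 4, Function.Injective ![i, j, k] →
        LinearIndependent ℂ ![![P 3, P 2, P 0, P 1] i, ![P 3, P 2, P 0, P 1] j,
          ![P 3, P 2, P 0, P 1] k] := by
      intro i j k hinj
      have := L4.comp _ hinj
      convert this using 1
      ext t
      fin_cases t <;> rfl
    have sp := span4 L4
    refine hcon (cayley_decomp v (hP 3) (hP 2) (hP 0) (hP 1) L4 ?_ ?_ ?_ ?_)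
    · intro h0
      exact planeCase v (hP 2) (hP 0) (hP 1) L3 sp h0 (p := P 3) (H.perm (by tauto))
    · intro h0
      refine planeCase v (e := P 2) (p := P 2) (hP 3) (hP 0) (hP 1) (sub 0 2 3 (by decide)) ?_ h0
        (H.perm (by tauto))
      intro w
      obtain ⟨a, x, y, z, rfl⟩ := sp w
      exact ⟨x, a, y, z, by abel⟩
    · intro h0
      refine planeCase v (e := P 0) (p := P 0) (hP 3) (hP 2) (hP 1) (sub 0 1 3 (by decide)) ?_ h0
        (H.perm (by tauto))
      intro w
      obtain ⟨a, x, y, z, rfl⟩ := sp w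
      exact ⟨y, a, x, z, by abel⟩
    · intro h0
      refine planeCase v (e := P 1) (p := P 1) (hP 3) (hP 2) (hP 0) (sub 0 1 2 (by decide)) ?_ h0
        (H.perm (by tauto))
      intro w
      obtain ⟨a, x, y, z, rfl⟩ := sp w
      exact ⟨z, a, x, y, by abel⟩

theorem stmt8 :
    ¬ ∃ f : MvPolynomial (Fin 4) ℂ, f.IsHomogeneous 3 ∧ hasRank 3 f 6 ∧
      ∃ A : Finset (Projectivization ℂ (Fin 4 → ℂ)), A.card = 4 ∧
        (↑A : Set (Projectivization ℂ (Fin 4 → ℂ)))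
          = {x : Projectivization ℂ (Fin 4 → ℂ) | ∀ i, eval x.rep (pderiv i f) = 0} := by
  rintro ⟨f, -, ⟨⟨v, rfl⟩, hmin⟩, A, hcard, hA⟩
  refine hmin 5 (by norm_num) ?_
  have hmem : ∀ x : Projectivization ℂ (Fin 4 → ℂ), x ∈ A ↔ SingVec v x.rep := by
    intro x
    rw [← singVec_iff, ← Finset.mem_coe, hA]
    rfl
  let E := (A.equivFinOfCardEq hcard).symm
  refine four_sing v (fun i => (E i).1.rep) (fun i => (hmem _).1 (E i).2) ?_ ?_
  · intro i j hij
    rw [LinearIndependent.pair_iff' (Projectivization.rep_nonzero _)]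
    intro c hc
    apply hij
    apply E.injective
    apply Subtype.ext
    rw [← Projectivization.mk_rep (E i).1, ← Projectivization.mk_rep (E j).1, eq_comm,
      Projectivization.mk_eq_mk_iff']
    exact ⟨c, hc⟩
  · intro u hu hs
    obtain ⟨t, ht⟩ := Projectivization.exists_smul_eq_mk_rep ℂ u hu
    have hin : Projectivization.mk ℂ u hu ∈ A := by
      rw [hmem, ← ht]
      intro w
      simp only [Units.smul_def, tri_smul2, tri_smul3, hs w]
      simp
    have hE : (E (E.symm ⟨_, hin⟩)).1 = Projectivization.mk ℂ u hu := by simp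
    have hex : ∃ c : ℂ, u = c • (E (E.symm ⟨_, hin⟩)).1.rep := by
      refine ⟨(t : ℂ)⁻¹, ?_⟩
      rw [hE, ← ht, Units.smul_def, smul_smul]
      simp
    generalize E.symm ⟨_, hin⟩ = k at hex
    fin_cases k
    · exact Or.inl hex
    · exact Or.inr (Or.inl hex)
    · exact Or.inr (Or.inr (Or.inl hex))
    · exact Or.inr (Or.inr (Or.inr hex))
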